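/- arXiv:0806.4958 — 4 statements merged into one kernel-verified Lean document; each statement's English description precedes it below -/
import Mathlib

section
/- Let x be a real number with ‖x‖ ≤ 1/4 and sin(2πx) ≠ 0, and let L be a positive integer. Then |sin(2πLx)| ≤ (3L / (1 + L‖x‖)) · |sin(2πx)|. Moreover, the bound H_L(x) = 3L/(1 + L‖x‖) is monotone in L: for positive integers j ≤ k and any real x, 3j/(1 + j‖x‖) ≤ 3k/(1 + k‖x‖). -/
/-- `‖x‖`, the distance from `x` to the nearest integer: `min_{A ∈ ℤ} |x - A|`. -/
noncomputable def nearestIntDist (x : ℝ) : ℝ := |x - round x|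

/-- `|sin (nθ)| ≤ n |sin θ|`. -/
theorem abs_sin_nat_mul_le_aux (n : ℕ) (t : ℝ) :
    |Real.sin (n * t)| ≤ n * |Real.sin t| := by
  induction n with
  | zero => simp
  | succ n ih =>
    have e : ((n + 1 : ℕ) : ℝ) * t = n * t + t := by push_cast; ring
    rw [e, Real.sin_add]
    have h1 : |Real.sin (n * t) * Real.cos t| ≤ |Real.sin (n * t)| := by
      rw [abs_mul]
      exact mul_le_of_le_one_right (abs_nonneg _) (Real.abs_cos_le_one _)
    have h2 : |Real.cos (n * t) * Real.sin t| ≤ |Real.sin t| := by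
      rw [abs_mul]
      exact mul_le_of_le_one_left (abs_nonneg _) (Real.abs_cos_le_one _)
    have h3 := abs_add_le (Real.sin (n * t) * Real.cos t) (Real.cos (n * t) * Real.sin t)
    push_cast
    linarith

/-- If `‖x‖ ≤ 1/4` and `sin(2πx) ≠ 0`, then for every positive integer `L`,
`|sin(2πLx)| ≤ (3L/(1 + L‖x‖)) |sin(2πx)|`; moreover the bound `H_L(x) = 3L/(1 + L‖x‖)` is
monotone in `L`. -/
theorem statement5 (x : ℝ) (hx : nearestIntDist x ≤ 1 / 4)
    (hsin : Real.sin (2 * Real.pi * x) ≠ 0) (L : ℕ) (hL : 0 < L) :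
    |Real.sin (2 * Real.pi * L * x)| ≤
      (3 * L / (1 + L * nearestIntDist x)) * |Real.sin (2 * Real.pi * x)| ∧
    ∀ j k : ℕ, 0 < j → j ≤ k → ∀ y : ℝ,
      3 * j / (1 + j * nearestIntDist y) ≤ 3 * k / (1 + k * nearestIntDist y) := by
  constructor
  · have hd : 0 ≤ nearestIntDist x := abs_nonneg _
    have hLr : (0 : ℝ) < L := by exact_mod_cast hL
    have h1 : |Real.sin (2 * Real.pi * L * x)| ≤ L * |Real.sin (2 * Real.pi * x)| := by
      have := abs_sin_nat_mul_le_aux L (2 * Real.pi * x)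
      rwa [show (L : ℝ) * (2 * Real.pi * x) = 2 * Real.pi * L * x by ring] at this
    have h2 : |Real.sin (2 * Real.pi * L * x)| ≤ 1 := Real.abs_sin_le_one _
    have h3 : 4 * nearestIntDist x ≤ |Real.sin (2 * Real.pi * x)| := by
      have e : Real.sin (2 * Real.pi * x) = Real.sin (2 * Real.pi * (x - round x)) := by
        rw [← Real.sin_sub_int_mul_two_pi (2 * Real.pi * x) (round x)]
        congr 1
        ring
      have ea : |2 * Real.pi * (x - round x)| = 2 * Real.pi * nearestIntDist x := by
        rw [abs_mul, abs_of_pos Real.two_pi_pos]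
        rfl
      have := Real.mul_abs_le_abs_sin (x := 2 * Real.pi * (x - round x)) (by
        rw [ea]
        nlinarith [Real.pi_pos])
      rw [e]
      rw [ea] at this
      have e2 : 2 / Real.pi * (2 * Real.pi * nearestIntDist x) = 4 * nearestIntDist x := by
        field_simp [Real.pi_ne_zero]
        ring
      linarith
    have hpos : 0 < 1 + L * nearestIntDist x := by positivity
    rw [div_mul_eq_mul_div, le_div_iff₀ hpos]
    have h4 := mul_le_mul_of_nonneg_right h2 (mul_nonneg hLr.le hd)
    have h5 := mul_le_mul_of_nonneg_left h3 hLr.le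
    have h6 : 0 ≤ L * |Real.sin (2 * Real.pi * x)| := by positivity
    nlinarith
  · intro j k hj hjk y
    have hd : 0 ≤ nearestIntDist y := abs_nonneg _
    have hjk' : (j : ℝ) ≤ k := by exact_mod_cast hjk
    rw [div_le_div_iff₀ (by positivity) (by positivity)]
    nlinarith
end

section
/- Let β ∈ (0,1/2) be irrational with continued fraction expansion [0; a₁, a₂, …] and convergent denominators B_k. Let m be a positive integer with Ostrowski representation m = Σ_{j=0}^{p} c_{j+1} B_j of type γ = γ(m) ≥ 1 (coefficients with index larger than p+1 taken to be 0). Then ‖mβ‖ ≥ (c_{γ+1} − 1)/(2 B_{γ+1}) + (a_{γ+2} − c_{γ+2})/(2 B_{γ+2}). -/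
/-- The Gauss-map iterates of `β`: `x_0 = β`, `x_{k+1} = 1/x_k - ⌊1/x_k⌋`. -/
noncomputable def gaussIter (β : ℝ) : ℕ → ℝ
  | 0 => β
  | k + 1 => 1 / gaussIter β k - ⌊1 / gaussIter β k⌋

/-- The `k`-th partial quotient (`k ≥ 1`) of the continued fraction `β = [0; a₁, a₂, …]`. -/
noncomputable def pq (β : ℝ) (k : ℕ) : ℤ := ⌊1 / gaussIter β (k - 1)⌋

/-- The continued fraction denominators: `B₀ = 1`, `B₁ = a₁`,
`B_{k+2} = a_{k+2} B_{k+1} + B_k`. -/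
noncomputable def cfB (β : ℝ) : ℕ → ℤ
  | 0 => 1
  | 1 => pq β 1
  | (k + 2) => pq β (k + 2) * cfB β (k + 1) + cfB β k

/-- `δ_k = |B_k β - A_k|`, as a product of Gauss iterates. -/
noncomputable def dl (β : ℝ) : ℕ → ℝ
  | 0 => β
  | k + 1 => dl β k * gaussIter β (k + 1)

/-- Alternating sums of length `N` starting from index `k`. -/
noncomputable def RR (β : ℝ) (c : ℕ → ℤ) : ℕ → ℕ → ℝ
  | 0, _ => 0
  | N + 1, k => c (k + 1) * dl β k - RR β c N (k + 1)

lemma gauss_prop (β : ℝ) (hirr : Irrational β) (h0 : 0 < β) (h1 : β < 1) (k : ℕ) :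
    Irrational (gaussIter β k) ∧ 0 < gaussIter β k ∧ gaussIter β k < 1 := by
  induction k with
  | zero => exact ⟨hirr, h0, h1⟩
  | succ k ih =>
    have hi : Irrational (gaussIter β (k + 1)) := by
      have h := ih.1.inv.sub_intCast ⌊1 / gaussIter β k⌋
      rw [← one_div] at h
      exact h
    refine ⟨hi, ?_, ?_⟩
    · refine lt_of_le_of_ne ?_ (fun h => hi.ne_zero h.symm)
      show 0 ≤ 1 / gaussIter β k - ⌊1 / gaussIter β k⌋
      linarith [Int.floor_le (1 / gaussIter β k)]
    · show 1 / gaussIter β k - ⌊1 / gaussIter β k⌋ < 1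
      linarith [Int.lt_floor_add_one (1 / gaussIter β k)]

lemma pq_pos (β : ℝ) (hirr : Irrational β) (h0 : 0 < β) (h1 : β < 1) (k : ℕ) :
    1 ≤ pq β k := by
  obtain ⟨_, hp, hl⟩ := gauss_prop β hirr h0 h1 (k - 1)
  rw [pq, Int.le_floor, Int.cast_one, le_div_iff₀ hp]
  linarith

lemma dl_pos (β : ℝ) (hirr : Irrational β) (h0 : 0 < β) (h1 : β < 1) (k : ℕ) :
    0 < dl β k := by
  induction k with
  | zero => exact h0
  | succ k ih => exact mul_pos ih (gauss_prop β hirr h0 h1 (k + 1)).2.1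

lemma dl_anti (β : ℝ) (hirr : Irrational β) (h0 : 0 < β) (h1 : β < 1) (k : ℕ) :
    dl β (k + 1) ≤ dl β k := by
  have h := gauss_prop β hirr h0 h1 (k + 1)
  exact mul_le_of_le_one_right (dl_pos β hirr h0 h1 k).le h.2.2.le

lemma dl_le (β : ℝ) (hirr : Irrational β) (h0 : 0 < β) (h1 : β < 1) (k : ℕ) :
    dl β k ≤ β := by
  induction k with
  | zero => exact le_rfl
  | succ k ih => exact (dl_anti β hirr h0 h1 k).trans ih

lemma dl_one (β : ℝ) (h0 : 0 < β) : dl β 1 = 1 - pq β 1 * β := by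
  show β * (1 / β - ⌊1 / β⌋) = 1 - (⌊1 / β⌋ : ℝ) * β
  field_simp

lemma dl_rec (β : ℝ) (hirr : Irrational β) (h0 : 0 < β) (h1 : β < 1) (k : ℕ) :
    dl β (k + 2) = dl β k - pq β (k + 2) * dl β (k + 1) := by
  have h := (gauss_prop β hirr h0 h1 (k + 1)).2.1
  show dl β k * gaussIter β (k + 1) * (1 / gaussIter β (k + 1) - ⌊1 / gaussIter β (k + 1)⌋)
    = dl β k - (⌊1 / gaussIter β (k + 1)⌋ : ℝ) * (dl β k * gaussIter β (k + 1))
  generalize (⌊1 / gaussIter β (k + 1)⌋ : ℝ) = a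
  field_simp

lemma cfB_prop (β : ℝ) (hirr : Irrational β) (h0 : 0 < β) (h1 : β < 1) (k : ℕ) :
    0 < cfB β k ∧ cfB β k ≤ cfB β (k + 1) := by
  induction k with
  | zero => exact ⟨by simp [cfB], by simpa [cfB] using pq_pos β hirr h0 h1 1⟩
  | succ k ih =>
    refine ⟨by linarith [ih.1, ih.2], ?_⟩
    have := pq_pos β hirr h0 h1 (k + 2)
    rw [show cfB β (k + 1 + 1) = pq β (k + 2) * cfB β (k + 1) + cfB β k from rfl]
    nlinarith [ih.1, ih.2]

lemma det_eq (β : ℝ) (hirr : Irrational β) (h0 : 0 < β) (h1 : β < 1) (k : ℕ) :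
    (cfB β (k + 1) : ℝ) * dl β k + cfB β k * dl β (k + 1) = 1 := by
  induction k with
  | zero =>
    rw [dl_one β h0]
    simp [cfB, dl]
  | succ k ih =>
    rw [show k + 1 + 1 = k + 2 from rfl, dl_rec β hirr h0 h1,
      show cfB β (k + 2) = pq β (k + 2) * cfB β (k + 1) + cfB β k from rfl]
    push_cast
    linarith

lemma dl_ge (β : ℝ) (hirr : Irrational β) (h0 : 0 < β) (h1 : β < 1) (k : ℕ) :
    1 / (2 * (cfB β (k + 1) : ℝ)) ≤ dl β k := by
  have hp : (0 : ℝ) < cfB β k := by exact_mod_cast (cfB_prop β hirr h0 h1 k).1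
  have hle : (cfB β k : ℝ) ≤ cfB β (k + 1) := by exact_mod_cast (cfB_prop β hirr h0 h1 k).2
  have hd := det_eq β hirr h0 h1 k
  have ha := dl_anti β hirr h0 h1 k
  have hp2 := dl_pos β hirr h0 h1 k
  rw [div_le_iff₀ (by linarith)]
  nlinarith [mul_le_mul hle ha (dl_pos β hirr h0 h1 (k + 1)).le (by linarith)]

lemma approx_two (β : ℝ) (hirr : Irrational β) (h0 : 0 < β) (h1 : β < 1) (k : ℕ) :
    (∃ A : ℤ, (cfB β k : ℝ) * β = A + (-1) ^ k * dl β k) ∧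
    (∃ A : ℤ, (cfB β (k + 1) : ℝ) * β = A + (-1) ^ (k + 1) * dl β (k + 1)) := by
  induction k with
  | zero =>
    refine ⟨⟨0, by simp [cfB, dl]⟩, ⟨1, ?_⟩⟩
    rw [dl_one β h0]
    simp [cfB]
  | succ k ih =>
    refine ⟨ih.2, ?_⟩
    obtain ⟨⟨A, hA⟩, ⟨A', hA'⟩⟩ := ih
    refine ⟨pq β (k + 2) * A' + A, ?_⟩
    rw [show k + 1 + 1 = k + 2 from rfl, dl_rec β hirr h0 h1,
      show cfB β (k + 2) = pq β (k + 2) * cfB β (k + 1) + cfB β k from rfl]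
    push_cast
    rw [add_mul, mul_assoc, hA, hA']
    ring

lemma RR_bound (β : ℝ) (hirr : Irrational β) (h0 : 0 < β) (h1 : β < 1) (c : ℕ → ℤ)
    (hcj : ∀ j, 1 ≤ j → 0 ≤ c (j + 1) ∧ c (j + 1) ≤ pq β (j + 1)) (N k : ℕ) :
    -dl β (k + 1) ≤ RR β c N (k + 1) ∧ RR β c N (k + 1) ≤ dl β k := by
  induction N generalizing k with
  | zero =>
    simp only [RR]
    exact ⟨by linarith [dl_pos β hirr h0 h1 (k + 1)], (dl_pos β hirr h0 h1 k).le⟩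
  | succ N ih =>
    have hp := dl_pos β hirr h0 h1 (k + 1)
    have hr := dl_rec β hirr h0 h1 k
    have hc := hcj (k + 1) (by omega)
    have hc0 : (0 : ℝ) ≤ c (k + 2) := by exact_mod_cast hc.1
    have hc2 : (c (k + 2) : ℝ) ≤ pq β (k + 2) := by exact_mod_cast hc.2
    have hi := ih (k + 1)
    rw [show k + 1 + 1 = k + 2 from rfl] at hi
    rw [show RR β c (N + 1) (k + 1) = c (k + 2) * dl β (k + 1) - RR β c N (k + 2) from rfl]
    have e1 := mul_nonneg hc0 hp.le
    have e2 := mul_le_mul_of_nonneg_right hc2 hp.le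
    constructor <;> linarith [hi.1, hi.2]

lemma RR_sum (β : ℝ) (c : ℕ → ℤ) (N k : ℕ) :
    ∑ j ∈ Finset.range N, (c (k + j + 1) : ℝ) * ((-1) ^ (k + j) * dl β (k + j))
      = (-1) ^ k * RR β c N k := by
  induction N generalizing k with
  | zero => simp [RR]
  | succ N ih =>
    rw [Finset.sum_range_succ']
    have h := ih (k + 1)
    have e : ∑ j ∈ Finset.range N, (c (k + (j + 1) + 1) : ℝ) *
        ((-1) ^ (k + (j + 1)) * dl β (k + (j + 1))) = (-1) ^ (k + 1) * RR β c N (k + 1) := by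
      rw [← h]
      apply Finset.sum_congr rfl
      intro j _
      rw [show k + (j + 1) = k + 1 + j by omega]
    rw [e, RR]
    simp only [add_zero]
    ring

/-- Let `β ∈ (0,1/2)` be irrational and let `m` have Ostrowski representation
`m = ∑_{j=0}^{p} c_{j+1} B_j` of type `γ = γ(m) ≥ 1`. Then
`‖mβ‖ ≥ (c_{γ+1} - 1)/(2B_{γ+1}) + (a_{γ+2} - c_{γ+2})/(2B_{γ+2})`. -/
theorem statement11 (β : ℝ) (hirr : Irrational β) (hβ : β ∈ Set.Ioo (0 : ℝ) (1 / 2))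
    (m : ℕ) (hm : 0 < m) (p : ℕ) (c : ℕ → ℤ)
    (hrep : (m : ℤ) = ∑ j ∈ Finset.range (p + 1), c (j + 1) * cfB β j)
    (hc1 : 0 ≤ c 1 ∧ c 1 < pq β 1)
    (hcj : ∀ j, 1 ≤ j → 0 ≤ c (j + 1) ∧ c (j + 1) ≤ pq β (j + 1))
    (hnext : ∀ j, 1 ≤ j → c (j + 1) = pq β (j + 1) → c j = 0)
    (htail : ∀ j, p + 1 < j → c j = 0)
    (γ : ℕ) (hγ1 : 1 ≤ γ) (hγne : c (γ + 1) ≠ 0) (hγmin : ∀ j, j < γ → c (j + 1) = 0) :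
    ((c (γ + 1) : ℝ) - 1) / (2 * (cfB β (γ + 1) : ℝ)) +
      ((pq β (γ + 2) : ℝ) - (c (γ + 2) : ℝ)) / (2 * (cfB β (γ + 2) : ℝ)) ≤
        nearestIntDist (m * β) := by
  obtain ⟨h0, hh⟩ := hβ
  have h1 : β < 1 := by linarith
  obtain ⟨g, rfl⟩ : ∃ g, γ = g + 1 := ⟨γ - 1, by omega⟩
  set N := p + 2 with hN
  -- extend the representation
  have hrep2 : (m : ℤ) = ∑ j ∈ Finset.range (g + 1 + N), c (j + 1) * cfB β j := by
    rw [hrep]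
    apply Finset.sum_subset
    · intro j hj
      simp only [Finset.mem_range] at hj ⊢
      omega
    · intro j _ hj
      simp only [Finset.mem_range] at hj
      rw [htail (j + 1) (by omega), zero_mul]
  choose A hA using fun k => (approx_two β hirr h0 h1 k).1
  have hmβ : (m : ℝ) * β = ((∑ j ∈ Finset.range (g + 1 + N), c (j + 1) * A j : ℤ) : ℝ)
      + (-1) ^ (g + 1) * RR β c N (g + 1) := by
    have hz : ∑ j ∈ Finset.range (g + 1), (c (j + 1) : ℝ) * ((-1) ^ j * dl β j) = 0 := by
      apply Finset.sum_eq_zero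
      intro j hj
      rw [hγmin j (Finset.mem_range.mp hj)]
      simp
    have hs : ∑ j ∈ Finset.range (g + 1 + N), (c (j + 1) : ℝ) * ((-1) ^ j * dl β j)
        = (-1) ^ (g + 1) * RR β c N (g + 1) := by
      rw [Finset.sum_range_add, hz, zero_add, RR_sum]
    have hm' : (m : ℝ) = ∑ j ∈ Finset.range (g + 1 + N), (c (j + 1) : ℝ) * cfB β j := by
      exact_mod_cast hrep2
    rw [← hs, hm', Finset.sum_mul]
    push_cast
    rw [← Finset.sum_add_distrib]
    apply Finset.sum_congr rfl
    intro j _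
    rw [mul_assoc, hA]
    ring
  have hub := (RR_bound β hirr h0 h1 c hcj N g).2
  have hub2 := dl_le β hirr h0 h1 g
  have hlb : ((c (g + 1 + 1) : ℝ) - 1) / (2 * (cfB β (g + 1 + 1) : ℝ)) +
      ((pq β (g + 1 + 2) : ℝ) - (c (g + 1 + 2) : ℝ)) / (2 * (cfB β (g + 1 + 2) : ℝ))
        ≤ RR β c N (g + 1) := by
    have hR : RR β c N (g + 1) = c (g + 1 + 1) * dl β (g + 1)
        - (c (g + 1 + 2) * dl β (g + 1 + 1) - RR β c p (g + 2 + 1)) := rfl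
    have hb := (RR_bound β hirr h0 h1 c hcj p (g + 2)).1
    have hr := dl_rec β hirr h0 h1 (g + 1)
    have d1 := dl_ge β hirr h0 h1 (g + 1)
    have d2 := dl_ge β hirr h0 h1 (g + 1 + 1)
    have q1 : (1 : ℝ) ≤ c (g + 1 + 1) := by
      have := (hcj (g + 1) (by omega)).1
      have h3 : 1 ≤ c (g + 1 + 1) := by omega
      exact_mod_cast h3
    have q2 : (c (g + 1 + 2) : ℝ) ≤ pq β (g + 1 + 2) := by
      exact_mod_cast (hcj (g + 1 + 1) (by omega)).2
    have e1 := mul_le_mul_of_nonneg_left d1 (sub_nonneg.mpr q1)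
    have e2 := mul_le_mul_of_nonneg_left d2 (sub_nonneg.mpr q2)
    rw [mul_one_div] at e1 e2
    rw [hR]
    rw [show g + 1 + 1 + 1 = g + 1 + 2 from rfl] at e2
    rw [show g + 2 + 1 = g + 1 + 2 from rfl] at hb ⊢
    linarith
  have hpos : 0 ≤ RR β c N (g + 1) := by
    refine le_trans ?_ hlb
    have q1 : (1 : ℝ) ≤ c (g + 1 + 1) := by
      have := (hcj (g + 1) (by omega)).1
      have h3 : 1 ≤ c (g + 1 + 1) := by omega
      exact_mod_cast h3
    have q2 : (c (g + 1 + 2) : ℝ) ≤ pq β (g + 1 + 2) := by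
      exact_mod_cast (hcj (g + 1 + 1) (by omega)).2
    have b1 : (0 : ℝ) < cfB β (g + 1 + 1) := by
      exact_mod_cast (cfB_prop β hirr h0 h1 (g + 1 + 1)).1
    have b2 : (0 : ℝ) < cfB β (g + 1 + 2) := by
      exact_mod_cast (cfB_prop β hirr h0 h1 (g + 1 + 2)).1
    exact add_nonneg (div_nonneg (by linarith) (by linarith))
      (div_nonneg (by linarith) (by linarith))
  refine hlb.trans ?_
  set T := RR β c N (g + 1) with hT
  set S : ℝ := (-1) ^ (g + 1) * T with hS
  have hSabs : |S| = T := by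
    rw [hS, abs_mul, abs_pow, abs_neg, abs_one, one_pow, one_mul, abs_of_nonneg hpos]
  unfold nearestIntDist
  rw [hmβ]
  generalize (∑ j ∈ Finset.range (g + 1 + N), c (j + 1) * A j) = M
  generalize round ((M : ℝ) + S) = r
  by_cases hMr : r = M
  · rw [hMr, add_sub_cancel_left, hSabs]
  · have hd : (1 : ℝ) ≤ |((r - M : ℤ) : ℝ)| := by
      have : 1 ≤ |r - M| := Int.one_le_abs (sub_ne_zero.mpr hMr)
      exact_mod_cast this
    have ht : |((r - M : ℤ) : ℝ)| ≤ |S| + |(M : ℝ) + S - r| := by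
      have := abs_sub S ((M : ℝ) + S - r)
      refine le_trans (le_of_eq ?_) this
      push_cast
      congr 1
      ring
    rw [hSabs] at ht
    linarith
end

section
/- Let β ∈ (0,1) be irrational with continued fraction denominators B_k, and let q and r be positive integers with Ostrowski coefficient sequences (c_j(q))_{j≥1} and (c_j(r))_{j≥1} respectively. Then q < r if and only if there exists an index l ≥ 1 such that c_l(q) < c_l(r) and c_j(q) ≤ c_j(r) for all j ≥ l. -/
/-- `c : ℕ → ℤ` (with `c 1, c 2, …` the coefficients, zero beyond some index `p+1`) is the
Ostrowski coefficient sequence of `m` with respect to `β`. -/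
def OstRep (β : ℝ) (m : ℕ) (c : ℕ → ℤ) : Prop :=
  (∃ p : ℕ, ((m : ℤ) = ∑ j ∈ Finset.range (p + 1), c (j + 1) * cfB β j) ∧
    (∀ j, p + 1 < j → c j = 0)) ∧
  (0 ≤ c 1 ∧ c 1 < pq β 1) ∧
  (∀ j, 1 ≤ j → 0 ≤ c (j + 1) ∧ c (j + 1) ≤ pq β (j + 1)) ∧
  (∀ j, 1 ≤ j → c (j + 1) = pq β (j + 1) → c j = 0)

/-- Partial sums of an Ostrowski expansion. -/
noncomputable def ostS (β : ℝ) (c : ℕ → ℤ) (n : ℕ) : ℤ :=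
  ∑ j ∈ Finset.range n, c (j + 1) * cfB β j

theorem ostS_succ (β : ℝ) (c : ℕ → ℤ) (n : ℕ) :
    ostS β c (n + 1) = ostS β c n + c (n + 1) * cfB β n := by
  simp [ostS, Finset.sum_range_succ]

theorem ost_cfB_nonneg {β : ℝ} {m : ℕ} {c : ℕ → ℤ} (h : OstRep β m c) (n : ℕ) :
    0 ≤ cfB β n ∧ 0 ≤ cfB β (n + 1) := by
  obtain ⟨-, h1, h2, -⟩ := h
  induction n with
  | zero => exact ⟨by simp [cfB], by simp only [cfB]; omega⟩
  | succ n ih =>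
    refine ⟨ih.2, ?_⟩
    have ha : 0 ≤ pq β (n + 2) := by
      have := h2 (n + 1) (by omega)
      exact this.1.trans this.2
    have := mul_nonneg ha ih.2
    simp only [cfB]
    linarith [ih.1]

theorem ost_nonneg {β : ℝ} {m : ℕ} {c : ℕ → ℤ} (h : OstRep β m c) (n : ℕ) :
    0 ≤ c (n + 1) := by
  rcases n with _ | n
  · exact h.2.1.1
  · exact (h.2.2.1 (n + 1) (by omega)).1

theorem ostS_nonneg {β : ℝ} {m : ℕ} {c : ℕ → ℤ} (h : OstRep β m c) (n : ℕ) :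
    0 ≤ ostS β c n :=
  Finset.sum_nonneg fun j _ => mul_nonneg (ost_nonneg h j) (ost_cfB_nonneg h j).1

theorem ostS_lt {β : ℝ} {m : ℕ} {c : ℕ → ℤ} (h : OstRep β m c) (n : ℕ) :
    ostS β c n < cfB β n ∧ ostS β c (n + 1) < cfB β (n + 1) := by
  induction n with
  | zero =>
    refine ⟨by simp [ostS, cfB], ?_⟩
    have := h.2.1.2
    simpa [ostS, cfB] using this
  | succ n ih =>
    refine ⟨ih.2, ?_⟩
    have hB := ost_cfB_nonneg h n
    have h2 := (h.2.2.1 (n + 1) (by omega)).2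
    have h3 := h.2.2.2 (n + 1) (by omega)
    rw [ostS_succ]
    have e : cfB β (n + 1 + 1) = pq β (n + 2) * cfB β (n + 1) + cfB β n := by
      simp only [cfB]
    rw [e]
    rcases eq_or_lt_of_le h2 with heq | hlt
    · have h0 := h3 heq
      rw [ostS_succ, h0, heq]
      linarith [ih.1]
    · have : (c (n + 1 + 1) + 1) * cfB β (n + 1) ≤ pq β (n + 2) * cfB β (n + 1) :=
        mul_le_mul_of_nonneg_right hlt hB.2
      linarith [ih.2, hB.1]

theorem ostS_eventually {β : ℝ} {m : ℕ} {c : ℕ → ℤ} (h : OstRep β m c) :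
    ∃ p, (∀ j, p < j → c j = 0) ∧ ∀ n, p ≤ n → (m : ℤ) = ostS β c n := by
  obtain ⟨⟨p, hp, hz⟩, -⟩ := h
  refine ⟨p + 1, hz, fun n hn => ?_⟩
  induction n, hn using Nat.le_induction with
  | base => exact hp
  | succ n hn ih => rw [ostS_succ, hz (n + 1) (by omega), ← ih]; ring

theorem ost_lt_of_top {β : ℝ} {q r : ℕ} {cq cr : ℕ → ℤ} (hcq : OstRep β q cq)
    (hcr : OstRep β r cr) (l : ℕ) (hl : cq (l + 1) < cr (l + 1))
    (he : ∀ j, l + 1 < j → cq j = cr j) : q < r := by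
  obtain ⟨p, -, hp⟩ := ostS_eventually hcq
  obtain ⟨p', -, hp'⟩ := ostS_eventually hcr
  have key : ∀ n, l + 1 ≤ n → ostS β cq n < ostS β cr n := by
    intro n hn
    induction n, hn using Nat.le_induction with
    | base =>
      rw [ostS_succ, ostS_succ]
      have : (cq (l + 1) + 1) * cfB β l ≤ cr (l + 1) * cfB β l :=
        mul_le_mul_of_nonneg_right hl (ost_cfB_nonneg hcq l).1
      linarith [ostS_nonneg hcr l, (ostS_lt hcq l).1]
    | succ n hn ih =>
      rw [ostS_succ, ostS_succ, he (n + 1) (by omega)]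
      linarith
  have := key (p + p' + l + 1) (by omega)
  rw [← hp _ (by omega), ← hp' _ (by omega)] at this
  exact_mod_cast this

/-- Two representations agree from index 1 on, or have a top index of disagreement. -/
theorem ost_top {β : ℝ} {q r : ℕ} {cq cr : ℕ → ℤ} (hcq : OstRep β q cq)
    (hcr : OstRep β r cr) : (∀ j, 1 ≤ j → cq j = cr j) ∨
    ∃ l, cq (l + 1) ≠ cr (l + 1) ∧ ∀ j, l + 1 < j → cq j = cr j := by
  obtain ⟨p, hp, -⟩ := ostS_eventually hcq
  obtain ⟨p', hp', -⟩ := ostS_eventually hcr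
  have key : ∀ n, (∀ j, n + 1 ≤ j → cq j = cr j) → (∀ j, 1 ≤ j → cq j = cr j) ∨
      ∃ l, cq (l + 1) ≠ cr (l + 1) ∧ ∀ j, l + 1 < j → cq j = cr j := by
    intro n
    induction n with
    | zero => exact fun h => Or.inl h
    | succ n ih =>
      intro h
      by_cases hn : cq (n + 1) = cr (n + 1)
      · apply ih
        intro j hj
        rcases eq_or_lt_of_le hj with rfl | hj
        · exact hn
        · exact h j hj
      · exact Or.inr ⟨n, hn, fun j hj => h j hj⟩
  exact key (p + p') fun j hj => by rw [hp j (by omega), hp' j (by omega)]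

/-- For irrational `β ∈ (0,1)` and positive integers `q, r` with Ostrowski
coefficient sequences `cq, cr`, one has `q < r` iff there is an index `l ≥ 1` with
`c_l(q) < c_l(r)` and `c_j(q) ≤ c_j(r)` for all `j ≥ l`. -/
theorem statement14 (β : ℝ) (hirr : Irrational β) (hβ : β ∈ Set.Ioo (0 : ℝ) 1)
    (q r : ℕ) (hq : 0 < q) (hr : 0 < r)
    (cq cr : ℕ → ℤ) (hcq : OstRep β q cq) (hcr : OstRep β r cr) :
    q < r ↔ ∃ l : ℕ, 1 ≤ l ∧ cq l < cr l ∧ ∀ j, l ≤ j → cq j ≤ cr j := by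
  constructor
  · intro hlt
    rcases ost_top hcq hcr with h | ⟨l, hne, he⟩
    · exfalso
      obtain ⟨p, -, hp⟩ := ostS_eventually hcq
      obtain ⟨p', -, hp'⟩ := ostS_eventually hcr
      have e : ostS β cq (p + p') = ostS β cr (p + p') :=
        Finset.sum_congr rfl fun j _ => by rw [h (j + 1) (by omega)]
      rw [← hp _ (by omega), ← hp' _ (by omega)] at e
      omega
    · rcases lt_or_gt_of_ne hne with hl | hl
      · refine ⟨l + 1, by omega, hl, fun j hj => ?_⟩
        rcases eq_or_lt_of_le hj with rfl | hj
        · exact hl.le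
        · exact (he j hj).le
      · have := ost_lt_of_top hcr hcq l hl fun j hj => (he j hj).symm
        omega
  · rintro ⟨k, hk, hklt, hkle⟩
    rcases ost_top hcq hcr with h | ⟨l, hne, he⟩
    · exact absurd (h k hk) hklt.ne
    · have hkl : k ≤ l + 1 := by
        by_contra hc
        exact hklt.ne (he k (by omega))
      exact ost_lt_of_top hcq hcr l (lt_of_le_of_ne (hkle _ hkl) hne) he
end

section
/- Let α be an irrational number and C_α > 0 a constant with ‖jα‖ ≥ C_α / j for every positive integer j. Let λ ≥ 1, let n ≥ 2 be an integer, let B and τ be positive integers with τ ≤ n, and define φ = (1/n) Σ_{j=1}^{⌊λn/B⌋} 1/(1 + n·j·‖Bτα‖). (i) If Bτ ≥ n^{η₁} and ‖Bτα‖ = n^{−η₂} with 1 ≤ η₂ ≤ η₁ ≤ 2, then φ ≤ c · λ · n^{min(1−η₁, η₂−2)} · log n for a constant c depending only on C_α. (ii) If instead ‖Bτα‖ ≥ 1/n, then φ ≤ (1/n) · log(λn + 1). -/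
theorem sum_aux (N : ℕ) :
    ∑ j ∈ Finset.Icc 1 N, 1 / (1 + (j : ℝ)) ≤ Real.log (N + 1) := by
  induction N with
  | zero => simp
  | succ k ih =>
    rw [Finset.sum_Icc_succ_top (by omega)]
    have hk : (0 : ℝ) < (k : ℝ) + 1 := by positivity
    have h := Real.one_sub_inv_le_log_of_pos
      (show (0 : ℝ) < ((k : ℝ) + 1 + 1) / ((k : ℝ) + 1) by positivity)
    rw [Real.log_div (by positivity) (by positivity)] at h
    have h2 : 1 - (((k : ℝ) + 1 + 1) / ((k : ℝ) + 1))⁻¹ = 1 / (1 + ((k : ℝ) + 1)) := by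
      field_simp
      ring
    push_cast
    linarith

/-- Let `α` be irrational with `‖jα‖ ≥ C_α/j` for all `j ≥ 1`, let `λ ≥ 1`,
`n ≥ 2`, `B, τ ≥ 1` with `τ ≤ n`, and `φ = (1/n) ∑_{j=1}^{⌊λn/B⌋} 1/(1 + n j ‖Bτα‖)`.
(i) If `Bτ ≥ n^{η₁}` and `‖Bτα‖ = n^{-η₂}` with `1 ≤ η₂ ≤ η₁ ≤ 2`, then
`φ ≤ c λ n^{min(1-η₁, η₂-2)} log n` for a constant `c` depending only on `C_α`.
(ii) If `‖Bτα‖ ≥ 1/n`, then `φ ≤ (1/n) log(λn + 1)`. -/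
theorem statement16 (Cα : ℝ) (hCα : 0 < Cα) :
    ∃ c : ℝ, 0 < c ∧
      ∀ (α lam : ℝ) (n B τ : ℕ),
        Irrational α →
        (∀ j : ℕ, 0 < j → Cα / j ≤ nearestIntDist (j * α)) →
        1 ≤ lam → 2 ≤ n → 0 < B → 0 < τ → τ ≤ n →
        ∀ φ : ℝ,
          φ = (1 / (n : ℝ)) * ∑ j ∈ Finset.Icc 1 ⌊lam * n / B⌋₊,
            1 / (1 + (n : ℝ) * (j : ℝ) * nearestIntDist (((B * τ : ℕ) : ℝ) * α)) →
          ((∀ η₁ η₂ : ℝ, 1 ≤ η₂ → η₂ ≤ η₁ → η₁ ≤ 2 →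
              (n : ℝ) ^ η₁ ≤ ((B * τ : ℕ) : ℝ) →
              nearestIntDist (((B * τ : ℕ) : ℝ) * α) = (n : ℝ) ^ (-η₂) →
              φ ≤ c * lam * (n : ℝ) ^ (min (1 - η₁) (η₂ - 2)) * Real.log n) ∧
           (1 / (n : ℝ) ≤ nearestIntDist (((B * τ : ℕ) : ℝ) * α) →
              φ ≤ (1 / (n : ℝ)) * Real.log (lam * n + 1))) := by
  refine ⟨4, by norm_num, ?_⟩
  intro α lam n B τ _ _ hlam hn hB hτ hτn φ hφ
  generalize nearestIntDist (((B * τ : ℕ) : ℝ) * α) = D at hφ ⊢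
  have hn2 : (2 : ℝ) ≤ n := by exact_mod_cast hn
  have hn0 : (0 : ℝ) < n := by linarith
  have hB1 : (1 : ℝ) ≤ B := by exact_mod_cast hB
  have hB0 : (0 : ℝ) < B := by linarith
  have hτn' : (τ : ℝ) ≤ n := by exact_mod_cast hτn
  have hfl : ((⌊lam * n / B⌋₊ : ℕ) : ℝ) ≤ lam * n / B := Nat.floor_le (by positivity)
  generalize ⌊lam * n / B⌋₊ = N at hfl hφ
  have hN : (N : ℝ) ≤ lam * n := hfl.trans (div_le_self (by positivity) hB1)
  have hlog : ∑ j ∈ Finset.Icc 1 N, 1 / (1 + (j : ℝ)) ≤ Real.log (lam * n + 1) :=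
    (sum_aux N).trans (Real.log_le_log (by positivity) (by linarith))
  have hlogn : (1 / 2 : ℝ) ≤ Real.log n := by
    have := Real.log_two_gt_d9
    have := Real.log_le_log (by norm_num) hn2
    linarith
  refine ⟨?_, ?_⟩
  · intro η₁ η₂ h1 h12 h2 hBτ hD
    have hDpos : 0 < D := hD ▸ Real.rpow_pos_of_pos hn0 _
    rcases min_choice (1 - η₁) (η₂ - 2) with hm | hm
    · rw [hm]
      have hs : ∑ j ∈ Finset.Icc 1 N, 1 / (1 + (n : ℝ) * (j : ℝ) * D) ≤ N := by
        calc _ ≤ ∑ j ∈ Finset.Icc 1 N, (1 : ℝ) := by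
              apply Finset.sum_le_sum
              intro j _
              rw [div_le_one (by positivity)]
              have : 0 ≤ (n : ℝ) * (j : ℝ) * D := by positivity
              linarith
          _ = N := by simp
      have hb : (n : ℝ) ^ (η₁ - 1) ≤ B := by
        rw [Real.rpow_sub_one hn0.ne', div_le_iff₀ hn0]
        push_cast at hBτ
        exact hBτ.trans (by gcongr)
      have hφ1 : φ ≤ lam * (n : ℝ) ^ (1 - η₁) := by
        calc φ ≤ (1 / (n : ℝ)) * (lam * n / B) := by
              rw [hφ]; gcongr; exact hs.trans hfl
          _ = lam * (B : ℝ)⁻¹ := by field_simp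
          _ ≤ lam * ((n : ℝ) ^ (η₁ - 1))⁻¹ := by gcongr
          _ = _ := by rw [← Real.rpow_neg hn0.le, neg_sub]
      have hp : 0 < lam * (n : ℝ) ^ (1 - η₁) := by positivity
      nlinarith
    · rw [hm]
      have hs : ∑ j ∈ Finset.Icc 1 N, 1 / (1 + (n : ℝ) * (j : ℝ) * D)
          ≤ (2 / (n * D)) * Real.log (lam * n + 1) := by
        calc _ ≤ ∑ j ∈ Finset.Icc 1 N, (2 / (n * D)) * (1 / (1 + (j : ℝ))) := by
              apply Finset.sum_le_sum
              intro j hj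
              have hj1 : (1 : ℝ) ≤ j := by exact_mod_cast (Finset.mem_Icc.1 hj).1
              rw [div_mul_div_comm, div_le_div_iff₀ (by positivity) (by positivity)]
              have : 0 < (n : ℝ) * D := by positivity
              nlinarith
          _ = (2 / (n * D)) * ∑ j ∈ Finset.Icc 1 N, 1 / (1 + (j : ℝ)) := by
              rw [Finset.mul_sum]
          _ ≤ _ := by gcongr
      have hl : Real.log (lam * n + 1) ≤ 2 * lam * Real.log n := by
        have h3 : Real.log (lam * n + 1) ≤ Real.log (lam * (n : ℝ) ^ 2) := by
          apply Real.log_le_log (by positivity)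
          nlinarith [mul_le_mul hlam hn2 (by norm_num) (by linarith)]
        rw [Real.log_mul (by positivity) (by positivity), Real.log_pow] at h3
        have h4 := Real.log_le_sub_one_of_pos (show 0 < lam by linarith)
        push_cast at h3
        nlinarith
      have hpow : (1 / (n : ℝ)) * (2 / (n * D)) = 2 * (n : ℝ) ^ (η₂ - 2) := by
        rw [hD, Real.rpow_neg hn0.le, Real.rpow_sub hn0, Real.rpow_two]
        field_simp
      calc φ ≤ (1 / (n : ℝ)) * ((2 / (n * D)) * Real.log (lam * n + 1)) := by
            rw [hφ]; gcongr
        _ = 2 * (n : ℝ) ^ (η₂ - 2) * Real.log (lam * n + 1) := by rw [← mul_assoc, hpow]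
        _ ≤ 2 * (n : ℝ) ^ (η₂ - 2) * (2 * lam * Real.log n) := by gcongr
        _ = _ := by ring
  · intro hD
    rw [hφ]
    have hD1 : 1 ≤ (n : ℝ) * D := by
      rw [div_le_iff₀ hn0] at hD
      linarith
    gcongr
    refine le_trans (Finset.sum_le_sum ?_) hlog
    intro j _
    apply one_div_le_one_div_of_le (by positivity)
    have : (0 : ℝ) ≤ j := by positivity
    nlinarith
end
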